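/- Suppose the primal SDP is strictly feasible (there exists X ≻ 0 with A_i • X = b_i for all i) and the dual SDP is strictly feasible (there exists y ∈ ℝ^m with A(y) ≻ 0). Then there exist a primal feasible matrix X̂ and a dual feasible vector ŷ with C • X̂ = bᵀŷ; in particular strong duality holds: the supremum of bᵀy over dual feasible y equals the infimum of C • X over primal feasible X, and both are attained. -/

import Mathlib

open Matrix BigOperators

open Set Filter Topology

section

variable {ι : Type*} [Fintype ι]

/-- The real square matrices, symmetric or not, whose quadratic form is positive away from `0`. -/
def posQuadForm (ι : Type*) [Fintype ι] : Set (Matrix ι ι ℝ) :=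
  {M | ∀ u : ι → ℝ, u ≠ 0 → 0 < u ⬝ᵥ (M *ᵥ u)}

theorem convex_posQuadForm : Convex ℝ (posQuadForm ι) := by
  refine convex_iff_forall_pos.2 fun M hM N hN a b ha hb _ u hu ↦ ?_
  have h₁ := mul_pos ha (hM u hu)
  have h₂ := mul_pos hb (hN u hu)
  simpa [add_mulVec, smul_mulVec, dotProduct_add] using add_pos h₁ h₂

theorem smul_mem_posQuadForm {M : Matrix ι ι ℝ} (hM : M ∈ posQuadForm ι) {t : ℝ} (ht : 0 < t) :
    t • M ∈ posQuadForm ι := fun u hu ↦ by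
  simpa [smul_mulVec] using mul_pos ht (hM u hu)

theorem isOpen_posQuadForm : IsOpen (posQuadForm ι) := by
  refine isOpen_iff_mem_nhds.2 fun M hM ↦ ?_
  have key : ∀ᶠ N in 𝓝 M, ∀ u ∈ Metric.sphere (0 : ι → ℝ) 1, 0 < u ⬝ᵥ (N *ᵥ u) := by
    refine (isCompact_sphere (0 : ι → ℝ) 1).eventually_forall_of_forall_eventually fun u hu ↦ ?_
    have hcont : Continuous fun z : Matrix ι ι ℝ × (ι → ℝ) ↦ z.2 ⬝ᵥ (z.1 *ᵥ z.2) := by fun_prop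
    exact hcont.continuousAt.eventually (lt_mem_nhds (hM u (ne_zero_of_mem_unit_sphere ⟨u, hu⟩)))
  filter_upwards [key] with N hN u hu
  have hpos : 0 < ‖u‖ := norm_pos_iff.2 hu
  have h := hN (‖u‖⁻¹ • u) (by simp [norm_smul, hpos.ne'])
  simp only [mulVec_smul, dotProduct_smul, smul_dotProduct, smul_eq_mul] at h
  exact pos_of_mul_pos_right (pos_of_mul_pos_right h (by positivity)) (by positivity)

theorem vecMulVec_add_smul_mem_posQuadForm {M : Matrix ι ι ℝ} (hM : M ∈ posQuadForm ι)
    (v : ι → ℝ) {ε : ℝ} (hε : 0 < ε) : vecMulVec v v + ε • M ∈ posQuadForm ι := fun u hu ↦ by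
  have h := mul_pos hε (hM u hu)
  have : u ⬝ᵥ ((vecMulVec v v + ε • M) *ᵥ u) = (v ⬝ᵥ u) ^ 2 + ε * (u ⬝ᵥ (M *ᵥ u)) := by
    simp [add_mulVec, smul_mulVec, dotProduct_add, vecMulVec_mulVec, dotProduct_comm u v, sq]
  rw [this]
  positivity

theorem trace_mul_vecMulVec_self (M : Matrix ι ι ℝ) (u : ι → ℝ) :
    (M * vecMulVec u u).trace = u ⬝ᵥ (M *ᵥ u) := by
  rw [mul_vecMulVec, trace_vecMulVec, dotProduct_comm]

theorem trace_mul_nonneg_of_quadForm_nonneg {S X : Matrix ι ι ℝ}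
    (hS : ∀ u : ι → ℝ, 0 ≤ u ⬝ᵥ (S *ᵥ u)) (hXs : X.IsSymm)
    (hX : ∀ u : ι → ℝ, 0 ≤ u ⬝ᵥ (X *ᵥ u)) : 0 ≤ (S * X).trace := by
  classical
  have hpsd : X.PosSemidef := .of_dotProduct_mulVec_nonneg
    (by rw [IsHermitian, conjTranspose_eq_transpose_of_trivial, hXs.eq]) hX
  open scoped MatrixOrder in
  obtain ⟨B, rfl⟩ := CStarAlgebra.nonneg_iff_eq_star_mul_self.1 hpsd.nonneg
  rw [← mul_assoc, trace_mul_comm, trace]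
  refine Finset.sum_nonneg fun i _ ↦ ?_
  refine (hS (B i)).trans_eq ?_
  simp [diag, mul_apply, dotProduct, mulVec, star_apply]

theorem abs_apply_le_trace {X : Matrix ι ι ℝ} (hXs : X.IsSymm)
    (hX : ∀ u : ι → ℝ, 0 ≤ u ⬝ᵥ (X *ᵥ u)) (i j : ι) : |X i j| ≤ X.trace := by
  classical
  have hdiag (k : ι) : 0 ≤ X k k := by simpa using hX (Pi.single k 1)
  have hle (k : ι) : X k k ≤ X.trace :=
    Finset.single_le_sum (f := fun k ↦ X k k) (fun k _ ↦ hdiag k) (Finset.mem_univ k)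
  have hadd := hX (Pi.single i 1 + Pi.single j 1)
  have hsub := hX (Pi.single i 1 - Pi.single j 1)
  simp [mulVec_add, mulVec_sub, dotProduct_add, dotProduct_sub] at hadd hsub
  have hij := hXs.apply i j
  have hi := hle i
  have hj := hle j
  rw [abs_le]
  constructor <;> linarith

theorem exists_pos_mul_trace_le {S : Matrix ι ι ℝ} (hS : S ∈ posQuadForm ι) :
    ∃ ε > 0, ∀ X : Matrix ι ι ℝ, X.IsSymm → (∀ u : ι → ℝ, 0 ≤ u ⬝ᵥ (X *ᵥ u)) →
      ε * X.trace ≤ (S * X).trace := by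
  classical
  have hcont : Continuous fun ε : ℝ ↦ S - ε • (1 : Matrix ι ι ℝ) := by fun_prop
  have hev : ∀ᶠ ε : ℝ in 𝓝 0, S - ε • (1 : Matrix ι ι ℝ) ∈ posQuadForm ι :=
    hcont.continuousAt.eventually (isOpen_posQuadForm.mem_nhds (by simpa using hS))
  obtain ⟨ε, hmem, hε⟩ :=
    ((hev.filter_mono nhdsWithin_le_nhds).and (self_mem_nhdsWithin (s := Ioi (0 : ℝ)))).exists
  refine ⟨ε, hε, fun X hXs hX ↦ ?_⟩
  have h := trace_mul_nonneg_of_quadForm_nonneg (S := S - ε • (1 : Matrix ι ι ℝ))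
    (fun u ↦ ?_) hXs hX
  · simpa [sub_mul] using h
  · obtain rfl | hu := eq_or_ne u 0
    · simp
    · exact (hmem u hu).le

theorem isCompact_setOf_trace_mul_le {S : Matrix ι ι ℝ} (hS : S ∈ posQuadForm ι) (R : ℝ) :
    IsCompact {X : Matrix ι ι ℝ | X.IsSymm ∧ (∀ u : ι → ℝ, 0 ≤ u ⬝ᵥ (X *ᵥ u)) ∧
      (S * X).trace ≤ R} := by
  obtain ⟨ε, hε, hbound⟩ := exists_pos_mul_trace_le hS
  have hbox : IsCompact (univ.pi fun _ : ι ↦ univ.pi fun _ : ι ↦ Icc (-(R / ε)) (R / ε)) :=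
    isCompact_univ_pi fun _ ↦ isCompact_univ_pi fun _ ↦ isCompact_Icc
  have hclosed : IsClosed {X : Matrix ι ι ℝ | ∀ u : ι → ℝ, 0 ≤ u ⬝ᵥ (X *ᵥ u)} := by
    simp only [ofPred_forall]
    exact isClosed_iInter fun u ↦ isClosed_le continuous_const (by fun_prop)
  have hsymm : IsClosed {X : Matrix ι ι ℝ | X.IsSymm} :=
    isClosed_eq (continuous_id.matrix_transpose) continuous_id
  have hle : IsClosed {X : Matrix ι ι ℝ | (S * X).trace ≤ R} :=
    isClosed_le (by fun_prop) continuous_const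
  refine IsCompact.of_isClosed_subset (X := Matrix ι ι ℝ) hbox ?_ ?_
  · exact hsymm.inter (hclosed.inter hle)
  · rintro X ⟨hXs, hX, hR⟩ i - j -
    refine abs_le.1 ((abs_apply_le_trace hXs hX i j).trans ?_)
    rw [le_div_iff₀' hε]
    exact (hbound X hXs hX).trans hR

theorem trace_sub_sum_smul_mul {κ : Type*} [Fintype κ] (C : Matrix ι ι ℝ)
    (A : κ → Matrix ι ι ℝ) (y : κ → ℝ) (X : Matrix ι ι ℝ) :
    ((C - ∑ i, y i • A i) * X).trace = (C * X).trace - ∑ i, y i * (A i * X).trace := by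
  simp [sub_mul, Finset.sum_mul, trace_sum]

theorem nonneg_of_forall_pos_add_mul_nonneg {k c : ℝ} (h : ∀ ε > 0, 0 ≤ k + ε * c) : 0 ≤ k := by
  by_contra! hk
  have hε : 0 < -k / (2 * (|c| + 1)) := div_pos (by linarith) (by positivity)
  have h₁ := h _ hε
  have h₂ := mul_le_mul_of_nonneg_left (show c ≤ |c| + 1 by linarith [le_abs_self c]) hε.le
  have h₃ : -k / (2 * (|c| + 1)) * (|c| + 1) = -k / 2 := by field_simp
  linarith

/-- A lower bound of the primal values over the interior of the cone is attained by the dual. -/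
theorem exists_dual_feasible_ge {κ : Type*} [Fintype κ] {C : Matrix ι ι ℝ}
    {A : κ → Matrix ι ι ℝ} {b : κ → ℝ} {p : ℝ} {X₀ : Matrix ι ι ℝ} (hX₀ : X₀ ∈ posQuadForm ι)
    (hAX₀ : ∀ i, (A i * X₀).trace = b i)
    (hp : ∀ X ∈ posQuadForm ι, (∀ i, (A i * X).trace = b i) → p ≤ (C * X).trace) :
    ∃ y : κ → ℝ, (∀ u : ι → ℝ, 0 ≤ u ⬝ᵥ ((C - ∑ i, y i • A i) *ᵥ u)) ∧ p ≤ ∑ i, b i * y i := by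
  let P : Set (Matrix ι ι ℝ × ℝ) := {z | z.1 ∈ posQuadForm ι ∧ (C * z.1).trace < z.2}
  let T : Set (Matrix ι ι ℝ × ℝ) := {z | (∀ i, (A i * z.1).trace = b i) ∧ z.2 ≤ p}
  have hPo : IsOpen P := (isOpen_posQuadForm.preimage continuous_fst).inter
    (isOpen_lt (by fun_prop) continuous_snd)
  have hPc : Convex ℝ P := by
    refine convex_iff_forall_pos.2 fun z hz w hw s t hs ht hst ↦
      ⟨convex_posQuadForm hz.1 hw.1 hs.le ht.le hst, ?_⟩
    have h₁ := mul_lt_mul_of_pos_left hz.2 hs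
    have h₂ := mul_lt_mul_of_pos_left hw.2 ht
    simpa [mul_add] using add_lt_add h₁ h₂
  have hTc : Convex ℝ T := by
    refine convex_iff_forall_pos.2 fun z hz w hw s t hs ht hst ↦ ⟨fun i ↦ ?_, ?_⟩
    · simp [mul_add, hz.1, hw.1, ← add_mul, hst]
    · have h₁ := mul_le_mul_of_nonneg_left hz.2 hs.le
      have h₂ := mul_le_mul_of_nonneg_left hw.2 ht.le
      have h₃ : s * p + t * p = p := by rw [← add_mul, hst, one_mul]
      simpa [h₃] using add_le_add h₁ h₂
  have hdisj : Disjoint P T := Set.disjoint_left.2 fun z hz hz' ↦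
    (hz.2.trans_le hz'.2).not_ge (hp _ hz.1 hz'.1)
  obtain ⟨f, r, hfP, hfT⟩ := geometric_hahn_banach_open hPc hPo hTc hdisj
  let h : Matrix ι ι ℝ →ₗ[ℝ] ℝ := f.toLinearMap ∘ₗ LinearMap.inl ℝ _ _
  let τ : ℝ := f (0, 1)
  have hf (X : Matrix ι ι ℝ) (t : ℝ) : f (X, t) = h X + t * τ := by
    have : (X, t) = (X, (0 : ℝ)) + t • ((0 : Matrix ι ι ℝ), (1 : ℝ)) := by simp
    rw [this, map_add, map_smul]
    rfl
  have hτ : τ < 0 := by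
    set q := max p ((C * X₀).trace + 1)
    have h₁ := hfP (X₀, q + 1)
      ⟨hX₀, by linarith [le_max_right p ((C * X₀).trace + 1)]⟩
    have h₂ := hfT (X₀, p) ⟨hAX₀, le_rfl⟩
    rw [hf] at h₁ h₂
    nlinarith [le_max_left p ((C * X₀).trace + 1)]
  have hker : ⨅ i, LinearMap.ker (traceLinearMap ι ℝ ℝ ∘ₗ LinearMap.mulLeft ℝ (A i)) ≤
      LinearMap.ker h := by
    intro D hD
    simp only [Submodule.mem_iInf, LinearMap.mem_ker, LinearMap.comp_apply,
      LinearMap.mulLeft_apply, traceLinearMap_apply] at hD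
    have hline (t : ℝ) : r ≤ h X₀ + t * h D + p * τ := by
      have := hfT (X₀ + t • D, p) ⟨fun i ↦ by simp [mul_add, hAX₀, hD], le_rfl⟩
      simpa [hf] using this
    by_contra hne
    have := hline ((r - h X₀ - p * τ - 1) / h D)
    rw [div_mul_cancel₀ _ hne] at this
    linarith
  obtain ⟨c, hc⟩ := (Submodule.mem_span_range_iff_exists_fun ℝ).1
    (mem_span_of_iInf_ker_le_ker hker)
  have hh (X : Matrix ι ι ℝ) : h X = ∑ i, c i * (A i * X).trace := by
    simp [← hc]
  let y : κ → ℝ := fun i ↦ c i / -τ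
  have hy (X : Matrix ι ι ℝ) : -τ * ∑ i, y i * (A i * X).trace = h X := by
    rw [hh, Finset.mul_sum]
    refine Finset.sum_congr rfl fun i _ ↦ ?_
    have : τ ≠ 0 := hτ.ne
    simp only [y]
    field_simp
  have hslack (X : Matrix ι ι ℝ) (hX : X ∈ posQuadForm ι) :
      0 ≤ r + -τ * ((C - ∑ i, y i • A i) * X).trace := by
    rw [trace_sub_sum_smul_mul, mul_sub, hy]
    refine nonneg_of_forall_pos_add_mul_nonneg (c := -τ) fun ε hε ↦ ?_
    have := hfP (X, (C * X).trace + ε) ⟨hX, by simpa using hε⟩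
    rw [hf] at this
    linarith
  have hr : 0 ≤ r := nonneg_of_forall_pos_add_mul_nonneg
    (c := -τ * ((C - ∑ i, y i • A i) * X₀).trace) fun ε hε ↦ by
      have := hslack _ (smul_mem_posQuadForm hX₀ hε)
      rw [mul_smul_comm, trace_smul, smul_eq_mul] at this
      linarith
  have hcone (X : Matrix ι ι ℝ) (hX : X ∈ posQuadForm ι) :
      0 ≤ ((C - ∑ i, y i • A i) * X).trace := by
    refine nonneg_of_mul_nonneg_right (a := -τ) ?_ (neg_pos.2 hτ)
    refine nonneg_of_forall_pos_add_mul_nonneg (c := r) fun ε hε ↦ ?_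
    have := hslack _ (smul_mem_posQuadForm hX (inv_pos.2 hε))
    rw [mul_smul_comm, trace_smul, smul_eq_mul] at this
    have := mul_nonneg hε.le this
    have hcancel : ε * ε⁻¹ = 1 := mul_inv_cancel₀ hε.ne'
    linear_combination this - τ * ((C - ∑ i, y i • A i) * X).trace * hcancel
  refine ⟨y, fun u ↦ ?_, ?_⟩
  · rw [← trace_mul_vecMulVec_self]
    refine nonneg_of_forall_pos_add_mul_nonneg
      (c := ((C - ∑ i, y i • A i) * X₀).trace) fun ε hε ↦ ?_
    have := hcone _ (vecMulVec_add_smul_mem_posQuadForm hX₀ u hε)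
    rwa [mul_add, mul_smul_comm, trace_add, trace_smul, smul_eq_mul] at this
  · have h₁ := hfT (X₀, p) ⟨hAX₀, le_rfl⟩
    rw [hf, ← hy] at h₁
    simp only [hAX₀] at h₁
    have h₂ : 0 ≤ -τ * (∑ i, y i * b i - p) := by linarith
    have h₃ := nonneg_of_mul_nonneg_right h₂ (neg_pos.2 hτ)
    simp only [mul_comm (b _)]
    linarith

/-- Dual strict feasibility makes the primal optimum attained. -/
theorem exists_primal_optimal {κ : Type*} [Fintype κ] {C : Matrix ι ι ℝ}
    {A : κ → Matrix ι ι ℝ} {b : κ → ℝ} {y : κ → ℝ}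
    (hy : C - ∑ i, y i • A i ∈ posQuadForm ι) {X₀ : Matrix ι ι ℝ} (hX₀s : X₀.IsSymm)
    (hX₀ : ∀ u : ι → ℝ, 0 ≤ u ⬝ᵥ (X₀ *ᵥ u)) (hAX₀ : ∀ i, (A i * X₀).trace = b i) :
    ∃ Xh : Matrix ι ι ℝ, Xh.IsSymm ∧ (∀ u : ι → ℝ, 0 ≤ u ⬝ᵥ (Xh *ᵥ u)) ∧
      (∀ i, (A i * Xh).trace = b i) ∧
      ∀ X : Matrix ι ι ℝ, X.IsSymm → (∀ u : ι → ℝ, 0 ≤ u ⬝ᵥ (X *ᵥ u)) →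
        (∀ i, (A i * X).trace = b i) → (C * Xh).trace ≤ (C * X).trace := by
  set S := C - ∑ i, y i • A i with hS
  have hSX (X : Matrix ι ι ℝ) (hX : ∀ i, (A i * X).trace = b i) :
      (S * X).trace = (C * X).trace - ∑ i, y i * b i := by
    simp [hS, trace_sub_sum_smul_mul, hX]
  have hclosed : IsClosed {X : Matrix ι ι ℝ | ∀ i, (A i * X).trace = b i} := by
    simp only [ofPred_forall]
    exact isClosed_iInter fun i ↦ isClosed_eq (by fun_prop) continuous_const
  have hcompact := (isCompact_setOf_trace_mul_le hy (S * X₀).trace).inter_right hclosed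
  obtain ⟨Xh, ⟨⟨hXhs, hXh, hle⟩, hAXh⟩, hmin⟩ := hcompact.exists_isMinOn
    ⟨X₀, ⟨hX₀s, hX₀, le_rfl⟩, hAX₀⟩
    (show Continuous fun X : Matrix ι ι ℝ ↦ (S * X).trace by fun_prop).continuousOn
  refine ⟨Xh, hXhs, hXh, hAXh, fun X hXs hX hAX ↦ ?_⟩
  have hopt : (S * Xh).trace ≤ (S * X).trace := by
    by_cases h : (S * X).trace ≤ (S * X₀).trace
    · exact hmin ⟨⟨hXs, hX, h⟩, hAX⟩
    · exact hle.trans (not_le.1 h).le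
  rw [hSX _ hAXh, hSX _ hAX] at hopt
  linarith

theorem trace_mul_symmetrization {M : Matrix ι ι ℝ} (hM : M.IsSymm) (X : Matrix ι ι ℝ) :
    (M * ((1 / 2 : ℝ) • (X + Xᵀ))).trace = (M * X).trace := by
  have : (M * Xᵀ).trace = (M * X).trace := by
    rw [← trace_transpose, transpose_mul, transpose_transpose, hM.eq, trace_mul_comm]
  rw [mul_smul_comm, mul_add, trace_smul, trace_add, this, smul_eq_mul]
  ring

theorem quadForm_symmetrization (X : Matrix ι ι ℝ) (u : ι → ℝ) :
    u ⬝ᵥ (((1 / 2 : ℝ) • (X + Xᵀ)) *ᵥ u) = u ⬝ᵥ (X *ᵥ u) := by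
  have : u ⬝ᵥ (Xᵀ *ᵥ u) = u ⬝ᵥ (X *ᵥ u) := by
    rw [mulVec_transpose, dotProduct_comm, dotProduct_mulVec]
  rw [smul_mulVec, add_mulVec, dotProduct_smul, dotProduct_add, this, smul_eq_mul]
  ring

end

/-- Strong duality for semidefinite programming under strict feasibility of both the
primal and the dual: there exist a primal feasible `Xh` and a dual feasible `yh`
with `C • Xh = bᵀyh`, and these are optimal for their respective problems
(so the primal infimum and dual supremum agree and both are attained). -/
theorem sdp_strong_duality (n m : ℕ)
    (C : Matrix (Fin n) (Fin n) ℝ) (A : Fin m → Matrix (Fin n) (Fin n) ℝ) (b : Fin m → ℝ)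
    (hC : C.IsSymm) (hA : ∀ i, (A i).IsSymm)
    (hprimal : ∃ X : Matrix (Fin n) (Fin n) ℝ, X.IsSymm ∧
      (∀ u : Fin n → ℝ, u ≠ 0 → 0 < u ⬝ᵥ (X *ᵥ u)) ∧ (∀ i, ((A i) * X).trace = b i))
    (hdual : ∃ y : Fin m → ℝ, ∀ u : Fin n → ℝ, u ≠ 0 →
      0 < u ⬝ᵥ ((C - ∑ i, y i • A i) *ᵥ u)) :
    ∃ (Xh : Matrix (Fin n) (Fin n) ℝ) (yh : Fin m → ℝ),
      Xh.IsSymm ∧ (∀ u : Fin n → ℝ, 0 ≤ u ⬝ᵥ (Xh *ᵥ u)) ∧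
      (∀ i, ((A i) * Xh).trace = b i) ∧
      (∀ u : Fin n → ℝ, 0 ≤ u ⬝ᵥ ((C - ∑ i, yh i • A i) *ᵥ u)) ∧
      (C * Xh).trace = ∑ i, b i * yh i ∧
      (∀ X : Matrix (Fin n) (Fin n) ℝ, X.IsSymm → (∀ u : Fin n → ℝ, 0 ≤ u ⬝ᵥ (X *ᵥ u)) →
        (∀ i, ((A i) * X).trace = b i) → (C * Xh).trace ≤ (C * X).trace) ∧
      (∀ y : Fin m → ℝ, (∀ u : Fin n → ℝ, 0 ≤ u ⬝ᵥ ((C - ∑ i, y i • A i) *ᵥ u)) →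
        ∑ i, b i * y i ≤ ∑ i, b i * yh i) := by
  obtain ⟨X₀, hX₀s, hX₀, hAX₀⟩ := hprimal
  obtain ⟨y₀, hy₀⟩ := hdual
  have hnonneg {X : Matrix (Fin n) (Fin n) ℝ} (hX : X ∈ posQuadForm (Fin n)) (u : Fin n → ℝ) :
      0 ≤ u ⬝ᵥ (X *ᵥ u) := by
    obtain rfl | hu := eq_or_ne u 0
    · simp
    · exact (hX u hu).le
  obtain ⟨Xh, hXhs, hXh, hAXh, hopt⟩ := exists_primal_optimal hy₀ hX₀s (hnonneg hX₀) hAX₀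
  obtain ⟨yh, hyh, hge⟩ := exists_dual_feasible_ge (C := C) (p := (C * Xh).trace) hX₀ hAX₀
    fun X hX hAX ↦ by
      rw [← trace_mul_symmetrization hC X]
      refine hopt _ ?_ (fun u ↦ ?_) fun i ↦ ?_
      · exact (isSymm_add_transpose_self X).smul _
      · rw [quadForm_symmetrization]
        exact hnonneg hX u
      · rw [trace_mul_symmetrization (hA i), hAX]
  have hweak (y : Fin m → ℝ) (hy : ∀ u : Fin n → ℝ, 0 ≤ u ⬝ᵥ ((C - ∑ i, y i • A i) *ᵥ u)) :
      ∑ i, b i * y i ≤ (C * Xh).trace := by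
    have h := trace_mul_nonneg_of_quadForm_nonneg hy hXhs hXh
    rw [trace_sub_sum_smul_mul] at h
    simp only [hAXh, mul_comm (y _)] at h
    linarith
  exact ⟨Xh, yh, hXhs, hXh, hAXh, hyh, hge.antisymm (hweak yh hyh), hopt,
    fun y hy ↦ (hweak y hy).trans hge⟩
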